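/- arXiv:0902.1026 — 2 statements merged into one kernel-verified Lean document; each statement's English description precedes it below -/
import Mathlib

section
/- Let p ∈ (2/3, 1), let μ be any invariant probability distribution on ℕ for the kernel q_p, and let X be a random walk in the homogeneous 'have your cookie and eat it' environment ω ≡ p with X_0 = 1 almost surely. Then P(T_0 = ∞) = μ(0) = Σ_{j=0}^{∞} p^{j+1} μ(j). -/
open MeasureTheory Filter

noncomputable section

/-- The hitting time of site `x` by the process `X`, with value `⊤` if `x` is never hit. -/
def hitTime {Ω : Type*} (X : ℕ → Ω → ℤ) (x : ℤ) (ω : Ω) : ℕ∞ :=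
  ⨅ (n : ℕ) (_ : X n ω = x), (n : ℕ∞)

/-- The natural filtration of the process `X` at time `n`. -/
def natSA {Ω : Type*} (X : ℕ → Ω → ℤ) (n : ℕ) : MeasurableSpace Ω :=
  ⨆ m ∈ Finset.range (n + 1), MeasurableSpace.comap (X m) ⊤

/-- The event `A_n` that before time `n` the walk has never jumped leftward from its
current site `X_n`. -/
def freshEvent {Ω : Type*} (X : ℕ → Ω → ℤ) (n : ℕ) : Set Ω :=
  {ω | ∀ m < n, ¬(X m ω = X n ω ∧ X (m + 1) ω = X m ω - 1)}

/-- A random walk in the "have your cookie and eat it" environment `env`. -/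
structure IsCookieRW {Ω : Type*} [MeasurableSpace Ω] (P : Measure Ω)
    (env : ℤ → ℝ) (X : ℕ → Ω → ℤ) : Prop where
  envRange : ∀ x : ℤ, env x ∈ Set.Ico (1 / 2 : ℝ) 1
  meas : ∀ n, Measurable (X n)
  steps : ∀ n : ℕ, ∀ᵐ ω ∂P, |X (n + 1) ω - X n ω| = 1
  cond : ∀ n : ℕ,
    (P[Set.indicator {ω | X (n + 1) ω = X n ω + 1} (fun _ => (1 : ℝ)) | natSA X n])
      =ᵐ[P]
    fun ω => env (X n ω) * Set.indicator (freshEvent X n) (fun _ => (1 : ℝ)) ω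
      + (1 / 2) * Set.indicator (freshEvent X n)ᶜ (fun _ => (1 : ℝ)) ω

/-- The transition kernel of the leftward-jump count chain. -/
def qp (p : ℝ) (j k : ℕ) : ℝ :=
  if k = 0 then p ^ (j + 1)
  else (1 - p) * ∑ l ∈ Finset.range (j + 1),
    p ^ l * (Nat.choose (j - l + k - 1) (k - 1) : ℝ) * ((1 : ℝ) / 2) ^ (j - l + k)

/-- `μ` is an invariant probability distribution on `ℕ` for the kernel `qp p`. -/
def IsInvariantFor (p : ℝ) (μ : ℕ → ℝ) : Prop :=
  (∀ k, 0 ≤ μ k) ∧ (∑' k, μ k) = 1 ∧ ∀ k, (∑' j, μ j * qp p j k) = μ k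

open scoped Topology

section Kernel

theorem qp_zero_right (c : ℝ) (j : ℕ) : qp c j 0 = c ^ (j + 1) := by simp [qp]

theorem qp_zero_succ (c : ℝ) (k : ℕ) : qp c 0 (k + 1) = (1 - c) * (1 / 2) ^ (k + 1) := by
  simp [qp]

theorem qp_succ_succ_eq_choose (c : ℝ) (j k : ℕ) :
    qp c (j + 1) (k + 1) = c * qp c j (k + 1) +
      (1 - c) * (((j + 1 + k).choose k : ℝ) * (1 / 2) ^ (j + 1 + k + 1)) := by
  simp only [qp, Nat.succ_ne_zero, if_false]
  rw [Finset.sum_range_succ']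
  simp only [Nat.add_sub_add_right, pow_succ, Nat.sub_zero, pow_zero, one_mul]
  simp only [Nat.add_sub_cancel, Finset.mul_sum, mul_add, ← add_assoc, pow_add, pow_one]
  congr 1
  exact Finset.sum_congr rfl fun i _ => by ring

theorem qp_half (j k : ℕ) :
    qp (1 / 2) j k = ((j + k).choose k : ℝ) * (1 / 2) ^ (j + k + 1) := by
  induction j generalizing k with
  | zero => cases k with
    | zero => simp [qp_zero_right]
    | succ k => rw [qp_zero_succ]; simp; ring
  | succ j ih => cases k with
    | zero => simp [qp_zero_right]
    | succ k =>
      rw [qp_succ_succ_eq_choose, ih, show j + 1 + (k + 1) = (j + k + 1) + 1 by ring,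
        Nat.choose_succ_succ, show j + 1 + k = j + k + 1 by ring,
        show j + (k + 1) = j + k + 1 by ring]
      push_cast
      ring

/-- The law of the number of leftward jumps from a site before its `r`-th rightward jump, when the
first rightward attempts succeed with probability `c` until the first leftward jump. -/
def leftKer (c : ℝ) : ℕ → ℕ → ℝ
  | 0, k => if k = 0 then 1 else 0
  | j + 1, k => qp c j k

theorem leftKer_succ_zero (c : ℝ) (r : ℕ) : leftKer c (r + 1) 0 = c * leftKer c r 0 := by
  cases r <;> simp [leftKer, qp_zero_right, pow_succ']

theorem leftKer_succ_succ (c : ℝ) (r k : ℕ) :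
    leftKer c (r + 1) (k + 1) = c * leftKer c r (k + 1) + (1 - c) * leftKer (1 / 2) (r + 1) k := by
  cases r with
  | zero => simp only [leftKer, qp_zero_succ, qp_half]; simp
  | succ r => simp only [leftKer, qp_succ_succ_eq_choose, qp_half]

theorem leftKer_nonneg {c : ℝ} (h0 : 0 ≤ c) (h1 : c ≤ 1) (r k : ℕ) : 0 ≤ leftKer c r k := by
  have : 0 ≤ 1 - c := by linarith
  cases r with
  | zero => simp only [leftKer]; split_ifs <;> norm_num
  | succ r => simp only [leftKer, qp]; split_ifs <;> positivity

theorem hasSum_leftKer_half (r : ℕ) : HasSum (leftKer (1 / 2) r) 1 := by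
  cases r with
  | zero => exact hasSum_ite_eq (0 : ℕ) (1 : ℝ)
  | succ r =>
    have h := (hasSum_choose_mul_geometric_of_norm_lt_one r (r := (1 / 2 : ℝ))
      (by norm_num)).mul_left ((1 / 2) ^ (r + 1))
    have hf : leftKer (1 / 2) (r + 1) =
        fun k => (1 / 2) ^ (r + 1) * (((k + r).choose r : ℝ) * (1 / 2) ^ k) := by
      funext k
      change qp (1 / 2) r k = _
      rw [qp_half, Nat.add_comm r k, Nat.choose_symm_add]
      ring
    rwa [← hf, show (1 : ℝ) - 1 / 2 = 1 / 2 by norm_num, mul_one_div_cancel (by positivity)] at h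

theorem hasSum_leftKer (c : ℝ) (r : ℕ) : HasSum (leftKer c r) 1 := by
  induction r with
  | zero => exact hasSum_ite_eq (0 : ℕ) (1 : ℝ)
  | succ r ih =>
    rw [← hasSum_nat_add_iff' 1] at ih ⊢
    simp only [Finset.sum_range_one] at ih ⊢
    have h := (ih.mul_left c).add ((hasSum_leftKer_half (r + 1)).mul_left (1 - c))
    simp only [← leftKer_succ_succ] at h
    rwa [show c * (1 - leftKer c r 0) + (1 - c) * 1 = 1 - leftKer c (r + 1) 0 by
      rw [leftKer_succ_zero]; ring] at h

/-- The average of `g` under the law `leftKer c r`. -/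
def leftAvg (c : ℝ) (g : ℕ → ℝ) (r : ℕ) : ℝ := ∑' k, leftKer c r k * g k

variable {c : ℝ} {g g' : ℕ → ℝ}

theorem summable_leftKer_mul (h0 : 0 ≤ c) (h1 : c ≤ 1) (hg : ∀ k, g k ∈ Set.Icc (0 : ℝ) 1)
    (r : ℕ) : Summable fun k => leftKer c r k * g k :=
  (hasSum_leftKer c r).summable.of_nonneg_of_le
    (fun k => mul_nonneg (leftKer_nonneg h0 h1 r k) (hg k).1)
    fun k => mul_le_of_le_one_right (leftKer_nonneg h0 h1 r k) (hg k).2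

theorem leftAvg_zero (c : ℝ) (g : ℕ → ℝ) : leftAvg c g 0 = g 0 := by
  simp [leftAvg, leftKer]

theorem leftAvg_succ (h0 : 0 ≤ c) (h1 : c ≤ 1) (hg : ∀ k, g k ∈ Set.Icc (0 : ℝ) 1) (r : ℕ) :
    leftAvg c g (r + 1) =
      c * leftAvg c g r + (1 - c) * leftAvg (1 / 2) (fun k => g (k + 1)) (r + 1) := by
  have hs := summable_leftKer_mul h0 h1 hg
  have hh := summable_leftKer_mul (c := 1 / 2) (by norm_num) (by norm_num)
    (fun k => hg (k + 1)) (r + 1)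
  simp only [leftAvg]
  rw [(hs (r + 1)).tsum_eq_zero_add, (hs r).tsum_eq_zero_add, mul_add, ← tsum_mul_left,
    ← tsum_mul_left, add_assoc, ← (((summable_nat_add_iff 1).2 (hs r)).mul_left c).tsum_add
      (hh.mul_left (1 - c)), leftKer_succ_zero, mul_assoc]
  congr 2
  ext k
  rw [leftKer_succ_succ]
  ring

theorem leftAvg_mono (h0 : 0 ≤ c) (h1 : c ≤ 1) (hg : ∀ k, g k ∈ Set.Icc (0 : ℝ) 1)
    (hg' : ∀ k, g' k ∈ Set.Icc (0 : ℝ) 1) (h : ∀ k, g k ≤ g' k) (r : ℕ) :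
    leftAvg c g r ≤ leftAvg c g' r :=
  (summable_leftKer_mul h0 h1 hg r).tsum_le_tsum
    (fun k => mul_le_mul_of_nonneg_left (h k) (leftKer_nonneg h0 h1 r k))
    (summable_leftKer_mul h0 h1 hg' r)

theorem leftAvg_mem_Icc (h0 : 0 ≤ c) (h1 : c ≤ 1) (hg : ∀ k, g k ∈ Set.Icc (0 : ℝ) 1) (r : ℕ) :
    leftAvg c g r ∈ Set.Icc (0 : ℝ) 1 := by
  refine ⟨tsum_nonneg fun k => mul_nonneg (leftKer_nonneg h0 h1 r k) (hg k).1, ?_⟩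
  refine (leftAvg_mono (g' := fun _ => 1) h0 h1 hg (by simp) (fun k => (hg k).2) r).trans ?_
  simp [leftAvg, (hasSum_leftKer c r).tsum_eq]

theorem leftAvg_half_shift_le (hg : ∀ k, g k ∈ Set.Icc (0 : ℝ) 1) (ha : Antitone g) (r : ℕ) :
    leftAvg (1 / 2) (fun k => g (k + 1)) r ≤ leftAvg (1 / 2) g r :=
  leftAvg_mono (by norm_num) (by norm_num) (fun k => hg (k + 1)) hg (fun k => ha k.le_succ) r

theorem leftAvg_half_succ_le (hg : ∀ k, g k ∈ Set.Icc (0 : ℝ) 1) (ha : Antitone g) (r : ℕ) :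
    leftAvg (1 / 2) g (r + 1) ≤ leftAvg (1 / 2) g r := by
  have h1 := leftAvg_succ (c := 1 / 2) (by norm_num) (by norm_num) hg r
  have h2 := leftAvg_half_shift_le hg ha (r + 1)
  linarith

theorem leftAvg_half_le (h0 : 1 / 2 ≤ c) (h1 : c ≤ 1) (hg : ∀ k, g k ∈ Set.Icc (0 : ℝ) 1)
    (ha : Antitone g) (r : ℕ) : leftAvg (1 / 2) g r ≤ leftAvg c g r := by
  induction r with
  | zero => simp [leftAvg_zero]
  | succ r ih =>
    have e1 := leftAvg_succ (c := 1 / 2) (by norm_num) (by norm_num) hg r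
    have e2 := leftAvg_succ (c := c) (by linarith) h1 hg r
    have e3 := leftAvg_half_shift_le hg ha (r + 1)
    have e4 := leftAvg_half_succ_le hg ha r
    nlinarith

theorem antitone_leftAvg (h0 : 1 / 2 ≤ c) (h1 : c ≤ 1) (hg : ∀ k, g k ∈ Set.Icc (0 : ℝ) 1)
    (ha : Antitone g) : Antitone (leftAvg c g) := by
  refine antitone_nat_of_succ_le fun r => ?_
  have e2 := leftAvg_succ (c := c) (by linarith) h1 hg r
  have e3 := leftAvg_half_shift_le hg ha (r + 1)
  have e4 := leftAvg_half_succ_le hg ha r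
  have e5 := leftAvg_half_le h0 h1 hg ha r
  nlinarith

/-- The probability that the chain with kernel `qp p` started at `j` is at `0` after `n` steps. -/
def zeroProb (p : ℝ) : ℕ → ℕ → ℝ
  | 0, j => if j = 0 then 1 else 0
  | n + 1, j => leftAvg p (zeroProb p n) (j + 1)

variable {p : ℝ}

theorem zeroProb_mem_Icc (h0 : 0 ≤ p) (h1 : p ≤ 1) (n j : ℕ) :
    zeroProb p n j ∈ Set.Icc (0 : ℝ) 1 := by
  induction n generalizing j with
  | zero => simp only [zeroProb]; split_ifs <;> simp
  | succ n ih => exact leftAvg_mem_Icc h0 h1 ih _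

theorem antitone_zeroProb (h0 : 1 / 2 ≤ p) (h1 : p ≤ 1) (n : ℕ) : Antitone (zeroProb p n) := by
  induction n with
  | zero =>
    refine antitone_nat_of_succ_le fun j => ?_
    simp only [zeroProb, Nat.succ_ne_zero, if_false]
    split_ifs <;> simp
  | succ n ih =>
    exact fun i j hij => antitone_leftAvg h0 h1 (zeroProb_mem_Icc (by linarith) h1 n) ih
      (Nat.succ_le_succ hij)

theorem IsInvariantFor.summable {μ : ℕ → ℝ} (hμ : IsInvariantFor p μ) : Summable μ := by
  by_contra h
  have := hμ.2.1
  rw [tsum_eq_zero_of_not_summable h] at this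
  exact zero_ne_one this

theorem IsInvariantFor.tsum_mul_leftAvg {μ : ℕ → ℝ} (hμ : IsInvariantFor p μ) (h0 : 0 ≤ p)
    (h1 : p ≤ 1) (hg : ∀ k, g k ∈ Set.Icc (0 : ℝ) 1) :
    ∑' j, μ j * leftAvg p g (j + 1) = ∑' k, μ k * g k := by
  have hn : ∀ j k, 0 ≤ leftKer p (j + 1) k * g k := fun j k =>
    mul_nonneg (leftKer_nonneg h0 h1 _ k) (hg k).1
  have hs : Summable (Function.uncurry fun j k => μ j * (leftKer p (j + 1) k * g k)) := by
    refine (summable_prod_of_nonneg fun x => mul_nonneg (hμ.1 _) (hn _ _)).2 ⟨fun j => ?_, ?_⟩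
    · exact (summable_leftKer_mul h0 h1 hg (j + 1)).mul_left (μ j)
    · simp only [tsum_mul_left]
      exact hμ.summable.of_nonneg_of_le
        (fun j => mul_nonneg (hμ.1 j) (leftAvg_mem_Icc h0 h1 hg (j + 1)).1)
        fun j => mul_le_of_le_one_right (hμ.1 j) (leftAvg_mem_Icc h0 h1 hg (j + 1)).2
  calc ∑' j, μ j * leftAvg p g (j + 1)
      = ∑' j, ∑' k, μ j * (leftKer p (j + 1) k * g k) := by simp only [leftAvg, tsum_mul_left]
    _ = ∑' k, ∑' j, μ j * (leftKer p (j + 1) k * g k) := hs.tsum_comm.symm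
    _ = ∑' k, μ k * g k := by
      refine tsum_congr fun k => ?_
      simp only [← mul_assoc, tsum_mul_right]
      rw [← hμ.2.2 k]
      rfl

theorem IsInvariantFor.tsum_mul_zeroProb {μ : ℕ → ℝ} (hμ : IsInvariantFor p μ) (h0 : 0 ≤ p)
    (h1 : p ≤ 1) (n : ℕ) : ∑' j, μ j * zeroProb p n j = μ 0 := by
  induction n with
  | zero => simp [zeroProb]
  | succ n ih => rw [← ih]; exact hμ.tsum_mul_leftAvg h0 h1 (zeroProb_mem_Icc h0 h1 n)

theorem mul_zeroProb_sub_le (h0 : 1 / 2 ≤ p) (h1 : p ≤ 1) (n k : ℕ) :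
    leftKer p 1 k * (zeroProb p n 0 - zeroProb p n k) ≤ zeroProb p n 0 - zeroProb p (n + 1) 0 := by
  have hp : 0 ≤ p := by linarith
  have hs := summable_leftKer_mul hp h1 (zeroProb_mem_Icc hp h1 n) 1
  have hS := ((hasSum_leftKer p 1).mul_right (zeroProb p n 0)).sub hs.hasSum
  simp only [← mul_sub, one_mul] at hS
  exact le_hasSum hS k fun i _ => mul_nonneg (leftKer_nonneg hp h1 _ _)
    (sub_nonneg.2 (antitone_zeroProb h0 h1 n i.zero_le))

theorem IsInvariantFor.tendsto_zeroProb {μ : ℕ → ℝ} (hμ : IsInvariantFor p μ) (h0 : 1 / 2 ≤ p)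
    (h1 : p < 1) : Tendsto (fun n => zeroProb p n 0) atTop (𝓝 (μ 0)) := by
  have hp : 0 < p := by linarith
  have hpos : ∀ k, 0 < leftKer p 1 k := by
    intro k
    cases k with
    | zero => simpa [leftKer, qp_zero_right] using hp
    | succ k =>
      have : 0 < 1 - p := by linarith
      simp only [leftKer, qp_zero_succ]
      positivity
  have hdec : Antitone fun n => zeroProb p n 0 := by
    refine antitone_nat_of_succ_le fun n => ?_
    simpa using mul_zeroProb_sub_le h0 h1.le n 0
  obtain ⟨L, hL⟩ : ∃ L, Tendsto (fun n => zeroProb p n 0) atTop (𝓝 L) :=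
    ⟨_, tendsto_atTop_ciInf hdec
      ⟨0, by rintro _ ⟨n, rfl⟩; exact (zeroProb_mem_Icc hp.le h1.le n 0).1⟩⟩
  have hdiff : Tendsto (fun n => zeroProb p n 0 - zeroProb p (n + 1) 0) atTop (𝓝 0) := by
    simpa using hL.sub (hL.comp (tendsto_add_atTop_nat 1))
  have hLk : ∀ k, Tendsto (fun n => zeroProb p n k) atTop (𝓝 L) := by
    intro k
    have h : Tendsto (fun n => zeroProb p n 0 - zeroProb p n k) atTop (𝓝 0) := by
      refine squeeze_zero (fun n => sub_nonneg.2 (antitone_zeroProb h0 h1.le n k.zero_le))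
        (fun n => (le_div_iff₀' (hpos k)).2 (mul_zeroProb_sub_le h0 h1.le n k)) ?_
      simpa using hdiff.div_const (leftKer p 1 k)
    simpa using hL.sub h
  have hlim : Tendsto (fun n => ∑' j, μ j * zeroProb p n j) atTop (𝓝 (∑' j, μ j * L)) := by
    refine tendsto_tsum_of_dominated_convergence hμ.summable
      (fun k => (hLk k).const_mul (μ k)) (.of_forall fun n k => ?_)
    have hz := zeroProb_mem_Icc hp.le h1.le n k
    rw [Real.norm_of_nonneg (mul_nonneg (hμ.1 k) hz.1)]
    exact mul_le_of_le_one_right (hμ.1 k) hz.2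
  simp only [hμ.tsum_mul_zeroProb hp.le h1.le, tsum_mul_right, hμ.2.1, one_mul] at hlim
  rwa [tendsto_nhds_unique hlim tendsto_const_nhds] at hL

end Kernel

section Harmonic

/-- The success probability of the rightward attempt at `x` when leftward jumps have already
occurred exactly from the sites in `S`. -/
def stepProb (p : ℝ) (S : Finset ℤ) (x : ℤ) : ℝ := if x ∈ S then 1 / 2 else p

theorem stepProb_mem_Icc {p : ℝ} (h0 : 1 / 2 ≤ p) (h1 : p ≤ 1) (S : Finset ℤ) (x : ℤ) :
    stepProb p S x ∈ Set.Icc (1 / 2 : ℝ) 1 := by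
  unfold stepProb
  split_ifs
  · norm_num
  · exact ⟨h0, h1⟩

/-- The probability, for a walk at `x` with set `S` of sites already left-jumped from, that `0` is
not visited before `y + 1`, where `d` is the number of leftward jumps yet to come from `y + 1`. -/
def escapeProb (p : ℝ) (x : ℤ) (S : Finset ℤ) : ℕ → ℕ → ℝ
  | 0, d => if 0 < x ∧ d = 0 then 1 else 0
  | y + 1, d => leftAvg (stepProb p S (y + 1)) (escapeProb p x S y)
      (d + if x ≤ y + 1 then 1 else 0)

variable {p : ℝ}

theorem escapeProb_mem_Icc (h0 : 1 / 2 ≤ p) (h1 : p ≤ 1) (x : ℤ) (S : Finset ℤ) (y d : ℕ) :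
    escapeProb p x S y d ∈ Set.Icc (0 : ℝ) 1 := by
  induction y generalizing d with
  | zero => simp only [escapeProb]; split_ifs <;> simp
  | succ y ih =>
    have hc := stepProb_mem_Icc h0 h1 S (y + 1)
    exact leftAvg_mem_Icc (by linarith [hc.1]) hc.2 ih _

theorem escapeProb_of_nonpos (p : ℝ) {x : ℤ} (hx : x ≤ 0) (S : Finset ℤ) (y d : ℕ) :
    escapeProb p x S y d = 0 := by
  induction y generalizing d with
  | zero => simp [escapeProb, hx.not_gt]
  | succ y ih => simp [escapeProb, leftAvg, ih]

theorem escapeProb_of_lt (p : ℝ) {x : ℤ} {y : ℕ} (hx : (y : ℤ) < x) (S : Finset ℤ) :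
    escapeProb p x S y 0 = 1 := by
  induction y with
  | zero => simpa [escapeProb] using hx
  | succ y ih =>
    push_cast at hx
    have : ¬ x ≤ y + 1 := by omega
    simp only [escapeProb, this, if_false, leftAvg_zero, Nat.add_zero]
    exact ih (by omega)

theorem escapeProb_one_empty (p : ℝ) (y d : ℕ) :
    escapeProb p 1 ∅ y d = zeroProb p y d := by
  induction y generalizing d with
  | zero => simp [escapeProb, zeroProb]
  | succ y ih => simp [escapeProb, zeroProb, stepProb, funext ih]

theorem escapeProb_right (p : ℝ) {x : ℤ} {y : ℕ} (hx : 0 < x) (hy : (y : ℤ) < x) (S : Finset ℤ)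
    (d : ℕ) : escapeProb p (x + 1) S y d = escapeProb p x S y d := by
  induction y generalizing d with
  | zero => simp [escapeProb, hx, show 0 < x + 1 by omega]
  | succ y ih =>
    push_cast at hy
    have h1 : ¬ x ≤ y + 1 := by omega
    have h2 : ¬ x + 1 ≤ y + 1 := by omega
    simp only [escapeProb, h1, h2, if_false]
    rw [funext (ih (by omega))]

theorem stepProb_insert_of_ne (p : ℝ) {x z : ℤ} (h : z ≠ x) (S : Finset ℤ) :
    stepProb p (insert x S) z = stepProb p S z := by
  simp [stepProb, h]

theorem escapeProb_insert_of_lt (p : ℝ) {x x' : ℤ} {y : ℕ} (hy : (y : ℤ) < x) (S : Finset ℤ)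
    (d : ℕ) : escapeProb p x' (insert x S) y d = escapeProb p x' S y d := by
  induction y generalizing d with
  | zero => rfl
  | succ y ih =>
    push_cast at hy
    simp only [escapeProb]
    rw [funext (ih (by omega)), stepProb_insert_of_ne p (by omega)]

theorem escapeProb_left (p : ℝ) (y : ℕ) (S : Finset ℤ) (d : ℕ) :
    escapeProb p y (insert ((y : ℤ) + 1) S) y d = escapeProb p (y + 1) S y (d + 1) := by
  rw [escapeProb_insert_of_lt p (by omega)]
  cases y with
  | zero => simp [escapeProb]
  | succ y =>
    simp only [escapeProb]
    push_cast
    simp only [le_refl, if_true, show ¬ (y : ℤ) + 1 + 1 ≤ y + 1 by omega, if_false, Nat.add_zero]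
    congr 1
    funext k
    exact (escapeProb_right p (by omega) (by omega) S k).symm

theorem leftAvg_linear_comb {c a b : ℝ} {g g' : ℕ → ℝ} (h0 : 0 ≤ c) (h1 : c ≤ 1)
    (hg : ∀ k, g k ∈ Set.Icc (0 : ℝ) 1) (hg' : ∀ k, g' k ∈ Set.Icc (0 : ℝ) 1) (r : ℕ) :
    leftAvg c (fun k => a * g k + b * g' k) r = a * leftAvg c g r + b * leftAvg c g' r := by
  simp only [leftAvg]
  rw [← tsum_mul_left, ← tsum_mul_left, ← ((summable_leftKer_mul h0 h1 hg r).mul_left a).tsum_add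
    ((summable_leftKer_mul h0 h1 hg' r).mul_left b)]
  exact tsum_congr fun k => by ring

theorem escapeProb_harmonic (h0 : 1 / 2 ≤ p) (h1 : p ≤ 1) {x : ℤ} {y : ℕ} (hx : 0 < x)
    (hy : x ≤ y) (S : Finset ℤ) (d : ℕ) :
    escapeProb p x S y d = stepProb p S x * escapeProb p (x + 1) S y d +
      (1 - stepProb p S x) * escapeProb p (x - 1) (insert x S) y d := by
  induction y generalizing d with
  | zero => simp at hy; omega
  | succ y ih =>
    push_cast at hy
    have hc := stepProb_mem_Icc h0 h1 S (y + 1)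
    have hc0 : 0 ≤ stepProb p S (y + 1) := by linarith [hc.1]
    obtain rfl | hlt := hy.eq_or_lt
    · have hR : escapeProb p ((y : ℤ) + 1 + 1) S y = escapeProb p (y + 1) S y :=
        funext (escapeProb_right p hx (by omega) S)
      have hL : escapeProb p y (insert ((y : ℤ) + 1) S) y =
          fun d => escapeProb p (y + 1) S y (d + 1) := funext (escapeProb_left p y S)
      have hi : stepProb p (insert ((y : ℤ) + 1) S) (y + 1) = 1 / 2 := by simp [stepProb]
      simp only [escapeProb, le_refl, if_true, show ¬ (y : ℤ) + 1 + 1 ≤ y + 1 by omega, if_false,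
        Nat.add_zero, add_sub_cancel_right, hR, hL, hi, show (y : ℤ) ≤ y + 1 by omega]
      exact leftAvg_succ hc0 hc.2 (escapeProb_mem_Icc h0 h1 _ S y) d
    · simp only [escapeProb, hy, if_true, show x + 1 ≤ y + 1 by omega,
        show x - 1 ≤ y + 1 by omega]
      rw [stepProb_insert_of_ne p hlt.ne', funext (ih (by omega))]
      exact leftAvg_linear_comb hc0 hc.2 (escapeProb_mem_Icc h0 h1 _ _ y)
        (escapeProb_mem_Icc h0 h1 _ _ y) _

end Harmonic

section Walk

/-- The set of sites from which the walk has jumped leftward before time `n`. -/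
def leftSites {Ω : Type*} (X : ℕ → Ω → ℤ) (n : ℕ) (ω : Ω) : Finset ℤ :=
  ((Finset.range n).filter fun m => X (m + 1) ω = X m ω - 1).image fun m => X m ω

variable {Ω : Type*} {X : ℕ → Ω → ℤ}

theorem mem_leftSites {n : ℕ} {ω : Ω} {x : ℤ} :
    x ∈ leftSites X n ω ↔ ∃ m < n, X m ω = x ∧ X (m + 1) ω = X m ω - 1 := by
  simp only [leftSites, Finset.mem_image, Finset.mem_filter, Finset.mem_range]
  grind

theorem leftSites_zero (ω : Ω) : leftSites X 0 ω = ∅ := by simp [leftSites]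

theorem leftSites_succ (n : ℕ) (ω : Ω) :
    leftSites X (n + 1) ω =
      if X (n + 1) ω = X n ω - 1 then insert (X n ω) (leftSites X n ω) else leftSites X n ω := by
  ext x
  split_ifs with h <;> simp only [Finset.mem_insert, mem_leftSites, Nat.lt_succ_iff_lt_or_eq] <;>
    grind

theorem mem_freshEvent_iff {n : ℕ} {ω : Ω} : ω ∈ freshEvent X n ↔ X n ω ∉ leftSites X n ω := by
  simp only [freshEvent, Set.mem_ofPred_eq, mem_leftSites, not_exists, not_and]

/-- The walk has stayed in `{1, …, M}` up to time `n`. -/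
def stayEvent (X : ℕ → Ω → ℤ) (M n : ℕ) : Set Ω := {ω | ∀ m ≤ n, X m ω ∈ Set.Icc (1 : ℤ) M}

theorem measurable_natSA (X : ℕ → Ω → ℤ) {m n : ℕ} (h : m ≤ n) :
    @Measurable _ _ (natSA X n) _ (X m) :=
  Measurable.mono (comap_measurable (X m))
    (le_iSup₂ (f := fun m (_ : m ∈ Finset.range (n + 1)) => MeasurableSpace.comap (X m) ⊤) m
      (Finset.mem_range.2 (Nat.lt_succ_of_le h))) le_rfl

theorem natSA_mono (X : ℕ → Ω → ℤ) : Monotone (natSA X) := fun _ _ h =>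
  iSup₂_mono' fun m hm => ⟨m, Finset.range_mono (Nat.succ_le_succ h) hm, le_rfl⟩

theorem measurable_leftSites (X : ℕ → Ω → ℤ) (n : ℕ) :
    @Measurable _ _ (natSA X n) ⊤ (leftSites X n) := by
  induction n with
  | zero => simp only [funext leftSites_zero]; exact @measurable_const _ _ ⊤ (natSA X 0) _
  | succ n ih =>
    let : MeasurableSpace (Finset ℤ) := ⊤
    let := natSA X (n + 1)
    have h1 : Measurable (X (n + 1)) := measurable_natSA X le_rfl
    have h2 : Measurable (X n) := measurable_natSA X n.le_succ
    have h3 : Measurable (leftSites X n) := ih.mono (natSA_mono X n.le_succ) le_rfl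
    have h4 : Measurable fun q : ℤ × ℤ × Finset ℤ =>
      if q.1 = q.2.1 - 1 then insert q.2.1 q.2.2 else q.2.2 := measurable_of_countable _
    rw [funext (leftSites_succ n)]
    exact h4.comp (h1.prodMk (h2.prodMk h3))

theorem measurable_comp_state (X : ℕ → Ω → ℤ) (n : ℕ) (f : ℤ → Finset ℤ → ℝ) :
    @Measurable _ _ (natSA X n) _ fun ω => f (X n ω) (leftSites X n ω) := by
  let : MeasurableSpace (Finset ℤ) := ⊤
  let := natSA X n
  exact (measurable_of_countable fun q : ℤ × Finset ℤ => f q.1 q.2).comp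
    ((measurable_natSA X le_rfl).prodMk (measurable_leftSites X n))

theorem measurableSet_stayEvent (X : ℕ → Ω → ℤ) (M n : ℕ) :
    @MeasurableSet _ (natSA X n) (stayEvent X M n) := by
  let := natSA X n
  simp only [stayEvent, Set.ofPred_forall]
  exact .iInter fun m => .iInter fun h => measurable_natSA X h (MeasurableSet.of_discrete)

theorem antitone_stayEvent (X : ℕ → Ω → ℤ) (M : ℕ) : Antitone (stayEvent X M) :=
  fun _ _ h _ hω m hm => hω m (hm.trans h)

/-- The walk stays in `{1, …, M}` up to time `n` and then steps to `M + 1`. -/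
def exitEvent (X : ℕ → Ω → ℤ) (M n : ℕ) : Set Ω := stayEvent X M n ∩ {ω | X (n + 1) ω = M + 1}

theorem pairwise_disjoint_exitEvent (X : ℕ → Ω → ℤ) (M : ℕ) :
    Pairwise (Function.onFun Disjoint (exitEvent X M)) := by
  have h : ∀ m n, m < n → Disjoint (exitEvent X M m) (exitEvent X M n) := by
    refine fun m n hmn => Set.disjoint_left.2 fun ω h1 h2 => ?_
    have h3 := (h2.1 (m + 1) hmn).2
    have h4 : X (m + 1) ω = M + 1 := h1.2
    omega
  exact fun m n hmn => hmn.lt_or_gt.elim (h m n) fun h' => (h n m h').symm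

theorem hitTime_eq_top_iff {x : ℤ} {ω : Ω} : hitTime X x ω = ⊤ ↔ ∀ n, X n ω ≠ x := by
  simp [hitTime, iInf_eq_top]

variable [mΩ : MeasurableSpace Ω]

theorem natSA_le (hX : ∀ n, Measurable (X n)) (n : ℕ) : natSA X n ≤ mΩ :=
  iSup₂_le fun m _ => (hX m).comap_le

variable {P : Measure Ω} {p : ℝ}

/-- The expected value of `f` at the state following the state `(x, S)`. -/
def stepAvg (p : ℝ) (f : ℤ → Finset ℤ → ℝ) (x : ℤ) (S : Finset ℤ) : ℝ :=
  stepProb p S x * f (x + 1) S + (1 - stepProb p S x) * f (x - 1) (insert x S)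

theorem IsCookieRW.ae_step (hX : IsCookieRW P (fun _ => p) X) :
    ∀ᵐ ω ∂P, ∀ n, X (n + 1) ω = X n ω + 1 ∨ X (n + 1) ω = X n ω - 1 := by
  filter_upwards [ae_all_iff.2 hX.steps] with ω h n
  rcases (abs_eq (by norm_num)).1 (h n) with h | h <;> omega

theorem IsCookieRW.iUnion_exitEvent_ae_le (hX : IsCookieRW P (fun _ => p) X)
    (hX0 : ∀ᵐ ω ∂P, X 0 ω = 1) (M : ℕ) :
    ⋃ n, exitEvent X M n ≤ᵐ[P] {ω | ∀ k ≤ M, X k ω ≠ 0} := by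
  filter_upwards [hX.ae_step, hX0] with ω h1 h2 h3
  obtain ⟨n, hn⟩ := Set.mem_iUnion.1 h3
  have hle : ∀ n : ℕ, X n ω ≤ n + 1 := by
    intro n
    induction n with
    | zero => simp [h2]
    | succ n ih => rcases h1 n with h | h <;> (push_cast; omega)
  have hexit : X (n + 1) ω = M + 1 := hn.2
  intro k hk h0
  have := hle (n + 1)
  push_cast at this
  rcases Nat.lt_or_ge n k with hnk | hnk
  · obtain rfl : k = n + 1 := by omega
    omega
  · have := (hn.1 k hnk).1
    omega

variable [IsProbabilityMeasure P]

theorem IsCookieRW.integrable_indicator_state (hX : IsCookieRW P (fun _ => p) X)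
    {f : ℤ → Finset ℤ → ℝ} {C : ℝ} (hf : ∀ x S, |f x S| ≤ C) (n : ℕ) {B : Set Ω}
    (hB : MeasurableSet B) :
    Integrable (B.indicator fun ω => f (X n ω) (leftSites X n ω)) P :=
  (Integrable.of_bound (((measurable_comp_state X n f).mono (natSA_le hX.meas n)
    le_rfl).aestronglyMeasurable) C (.of_forall fun _ => hf _ _)).indicator hB

theorem IsCookieRW.setIntegral_step (hX : IsCookieRW P (fun _ => p) X)
    {f : ℤ → Finset ℤ → ℝ} {C : ℝ} (hf : ∀ x S, |f x S| ≤ C) (n : ℕ) {B : Set Ω}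
    (hB : @MeasurableSet _ (natSA X n) B) :
    ∫ ω in B, f (X (n + 1) ω) (leftSites X (n + 1) ω) ∂P =
      ∫ ω in B, stepAvg p f (X n ω) (leftSites X n ω) ∂P := by
  have hm := natSA_le hX.meas n
  set R : Set Ω := {ω | X (n + 1) ω = X n ω + 1} with hR
  have hRm : MeasurableSet R := measurableSet_eq_fun (hX.meas _) ((hX.meas _).add_const 1)
  set u : Ω → ℝ := fun ω => f (X n ω - 1) (insert (X n ω) (leftSites X n ω)) with hu
  set w : Ω → ℝ := fun ω => f (X n ω + 1) (leftSites X n ω) - u ω with hw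
  have hum : @Measurable _ _ (natSA X n) _ u :=
    measurable_comp_state X n fun x S => f (x - 1) (insert x S)
  have hwm : @Measurable _ _ (natSA X n) _ w :=
    measurable_comp_state X n fun x S => f (x + 1) S - f (x - 1) (insert x S)
  have hwb : ∀ ω, ‖w ω‖ ≤ C + C := fun ω => (norm_sub_le _ _).trans (add_le_add (hf _ _) (hf _ _))
  have hui : Integrable u P := .of_bound (hum.mono hm le_rfl).aestronglyMeasurable C
    (.of_forall fun _ => hf _ _)
  have hRi : Integrable (R.indicator fun _ => (1 : ℝ)) P := (integrable_const 1).indicator hRm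
  have hRw : Integrable ((R.indicator fun _ => (1 : ℝ)) * w) P :=
    hRi.mul_bdd (hwm.mono hm le_rfl).aestronglyMeasurable (.of_forall hwb)
  have hpull := condExp_mul_of_stronglyMeasurable_right (μ := P) (m := natSA X n)
    hwm.stronglyMeasurable hRw hRi
  have hstep : (fun ω => f (X (n + 1) ω) (leftSites X (n + 1) ω)) =ᵐ[P]
      fun ω => ((R.indicator fun _ => (1 : ℝ)) * w) ω + u ω := by
    filter_upwards [hX.ae_step] with ω h
    rcases h n with h | h
    · have : ω ∈ R := h
      simp [this, leftSites_succ, h, hw, show ¬ X n ω + 1 = X n ω - 1 by omega]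
    · have : ω ∉ R := by simp only [hR, Set.mem_ofPred_eq]; omega
      simp [this, leftSites_succ, h, hu]
  have hcond : P[(R.indicator fun _ => (1 : ℝ)) * w | natSA X n] =ᵐ[P]
      fun ω => stepProb p (leftSites X n ω) (X n ω) * w ω := by
    filter_upwards [hpull, hX.cond n] with ω h1 h2
    rw [h1, Pi.mul_apply, h2]
    by_cases h : X n ω ∈ leftSites X n ω <;> simp [Set.indicator, mem_freshEvent_iff, stepProb, h]
  rw [setIntegral_congr_ae (hm _ hB) (hstep.mono fun _ h _ => h),
    integral_add hRw.integrableOn hui.integrableOn, ← setIntegral_condExp hm hRw hB,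
    setIntegral_congr_ae (hm _ hB) (hcond.mono fun _ h _ => h), ← integral_add ?_ hui.integrableOn]
  · exact integral_congr_ae (.of_forall fun ω => by simp only [stepAvg, hw, hu]; ring)
  · exact (integrable_condExp.congr hcond).integrableOn

theorem IsCookieRW.tendsto_measureReal_stayEvent (hX : IsCookieRW P (fun _ => p) X) (M : ℕ) :
    Tendsto (fun n => P.real (stayEvent X M n)) atTop (𝓝 0) := by
  have hp := hX.envRange 0
  let φ : ℤ → Finset ℤ → ℝ := fun x _ =>
    if 0 ≤ x ∧ x ≤ M + 1 then ((M : ℝ) + 1) ^ 2 - (x : ℝ) ^ 2 else 0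
  have hφ : ∀ x S, 0 ≤ φ x S ∧ φ x S ≤ ((M : ℝ) + 1) ^ 2 := by
    intro x S
    simp only [φ]
    split_ifs with h
    · have h0 : (0 : ℝ) ≤ x := by exact_mod_cast h.1
      have h1 : (x : ℝ) ≤ M + 1 := by exact_mod_cast h.2
      constructor <;> nlinarith
    · exact ⟨le_rfl, by positivity⟩
  have hφC : ∀ x S, |φ x S| ≤ ((M : ℝ) + 1) ^ 2 := fun x S => by
    rw [abs_of_nonneg (hφ x S).1]; exact (hφ x S).2
  have hdrift : ∀ x S, x ∈ Set.Icc (1 : ℤ) M → stepAvg p φ x S ≤ φ x S - 1 := by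
    rintro x S ⟨h1, h2⟩
    have hc := stepProb_mem_Icc hp.1 hp.2.le S x
    have h1' : (1 : ℝ) ≤ x := by exact_mod_cast h1
    simp only [stepAvg, φ]
    rw [if_pos (by omega), if_pos (by omega), if_pos (by omega)]
    push_cast
    nlinarith [mul_nonneg (sub_nonneg.2 hc.1) (zero_le_one.trans h1')]
  have hm := fun n => natSA_le hX.meas n _ (measurableSet_stayEvent X M n)
  have hint : ∀ n, Integrable (fun ω => φ (X n ω) (leftSites X n ω)) P := fun n => by
    simpa using hX.integrable_indicator_state hφC n MeasurableSet.univ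
  let b : ℕ → ℝ := fun n => ∫ ω in stayEvent X M n, φ (X n ω) (leftSites X n ω) ∂P
  have hb : ∀ n, 0 ≤ b n := fun n => integral_nonneg fun ω => (hφ _ ∅).1
  have hstep : ∀ n, P.real (stayEvent X M n) ≤ b n - b (n + 1) := by
    intro n
    have h1 : b (n + 1) ≤
        ∫ ω in stayEvent X M n, φ (X (n + 1) ω) (leftSites X (n + 1) ω) ∂P :=
      setIntegral_mono_set (hint (n + 1)).integrableOn (.of_forall fun ω => (hφ _ ∅).1)
        (antitone_stayEvent X M n.le_succ).eventuallyLE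
    have h2 : ∫ ω in stayEvent X M n, stepAvg p φ (X n ω) (leftSites X n ω) ∂P ≤
        ∫ ω in stayEvent X M n, (φ (X n ω) (leftSites X n ω) - 1) ∂P := by
      refine integral_mono_of_nonneg (.of_forall fun ω => ?_)
        ((hint n).sub (integrable_const 1)).integrableOn ?_
      · have hc := stepProb_mem_Icc hp.1 hp.2.le (leftSites X n ω) (X n ω)
        exact add_nonneg (mul_nonneg (by linarith [hc.1]) (hφ _ ∅).1)
          (mul_nonneg (by linarith [hc.2]) (hφ _ ∅).1)
      · filter_upwards [ae_restrict_mem (hm n)] with ω hω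
        exact hdrift _ _ (hω n le_rfl)
    rw [integral_sub (hint n).integrableOn (integrable_const 1)] at h2
    rw [hX.setIntegral_step hφC n (measurableSet_stayEvent X M n)] at h1
    simp only [integral_const, measureReal_restrict_apply_univ, smul_eq_mul, mul_one] at h2
    simp only [b] at h1 ⊢
    linarith
  refine (summable_of_sum_range_le (c := b 0) (fun n => measureReal_nonneg)
    fun n => ?_).tendsto_atTop_zero
  calc ∑ i ∈ Finset.range n, P.real (stayEvent X M i)
      ≤ ∑ i ∈ Finset.range n, (b i - b (i + 1)) := Finset.sum_le_sum fun i _ => hstep i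
    _ = b 0 - b n := Finset.sum_range_sub' b n
    _ ≤ b 0 := by linarith [hb n]

theorem measurableSet_exitEvent (hX : ∀ n, Measurable (X n)) (M n : ℕ) :
    MeasurableSet (exitEvent X M n) :=
  (natSA_le hX n _ (measurableSet_stayEvent X M n)).inter
    (hX (n + 1) (measurableSet_singleton _))

theorem IsCookieRW.hasSum_measureReal_exitEvent (hX : IsCookieRW P (fun _ => p) X)
    (hX0 : ∀ᵐ ω ∂P, X 0 ω = 1) {M : ℕ} (hM : 1 ≤ M) :
    HasSum (fun n => P.real (exitEvent X M n)) (zeroProb p M 0) := by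
  have hp := hX.envRange 0
  let h : ℤ → Finset ℤ → ℝ := fun x S => escapeProb p x S M 0
  have hh : ∀ x S, h x S ∈ Set.Icc (0 : ℝ) 1 := fun x S => escapeProb_mem_Icc hp.1 hp.2.le x S M 0
  have hhC : ∀ x S, |h x S| ≤ 1 := fun x S => by rw [abs_of_nonneg (hh x S).1]; exact (hh x S).2
  have hm := fun n => natSA_le hX.meas n _ (measurableSet_stayEvent X M n)
  let a : ℕ → ℝ := fun n => ∫ ω in stayEvent X M n, h (X n ω) (leftSites X n ω) ∂P
  have hstep : ∀ n, P.real (exitEvent X M n) = a n - a (n + 1) := by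
    intro n
    have h1 : a n = ∫ ω in stayEvent X M n, h (X (n + 1) ω) (leftSites X (n + 1) ω) ∂P := by
      rw [hX.setIntegral_step hhC n (measurableSet_stayEvent X M n)]
      exact setIntegral_congr_fun (hm n) fun ω hω =>
        escapeProb_harmonic hp.1 hp.2.le (hω n le_rfl).1 (hω n le_rfl).2 _ 0
    have h2 : (stayEvent X M n).indicator (fun ω => h (X (n + 1) ω) (leftSites X (n + 1) ω)) =ᵐ[P]
        (stayEvent X M (n + 1)).indicator (fun ω => h (X (n + 1) ω) (leftSites X (n + 1) ω)) +
          (exitEvent X M n).indicator fun _ => (1 : ℝ) := by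
      filter_upwards [hX.ae_step] with ω hω
      have hsucc : ω ∈ stayEvent X M (n + 1) ↔
          ω ∈ stayEvent X M n ∧ X (n + 1) ω ∈ Set.Icc (1 : ℤ) M := by
        refine ⟨fun H => ⟨antitone_stayEvent X M n.le_succ H, H _ le_rfl⟩, fun H m hmn => ?_⟩
        rcases hmn.lt_or_eq with hmn | rfl
        · exact H.1 m (Nat.le_of_lt_succ hmn)
        · exact H.2
      have hexit : ω ∈ exitEvent X M n ↔ ω ∈ stayEvent X M n ∧ X (n + 1) ω = M + 1 := Iff.rfl
      rw [Pi.add_apply]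
      by_cases hs : ω ∈ stayEvent X M n
      · have hr := hs n le_rfl
        simp only [Set.mem_Icc] at hr hsucc
        by_cases e1 : X (n + 1) ω = M + 1
        · have : h (X (n + 1) ω) (leftSites X (n + 1) ω) = 1 :=
            escapeProb_of_lt p (by omega) _
          rw [Set.indicator_of_mem hs, Set.indicator_of_notMem (by rw [hsucc]; omega),
            Set.indicator_of_mem (hexit.2 ⟨hs, e1⟩), this, zero_add]
        · rw [Set.indicator_of_mem hs,
            Set.indicator_of_notMem (s := exitEvent X M n) (by rw [hexit]; tauto), add_zero]
          by_cases e2 : X (n + 1) ω = 0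
          · have : h (X (n + 1) ω) (leftSites X (n + 1) ω) = 0 :=
              escapeProb_of_nonpos p e2.le _ _ _
            rw [Set.indicator_of_notMem (by rw [hsucc]; omega), this]
          · rw [Set.indicator_of_mem (hsucc.2 ⟨hs, by rcases hω n with h | h <;> omega⟩)]
      · rw [Set.indicator_of_notMem hs, Set.indicator_of_notMem (by rw [hsucc]; tauto),
          Set.indicator_of_notMem (by rw [hexit]; tauto), add_zero]
    have hme := measurableSet_exitEvent hX.meas M n
    rw [h1, ← integral_indicator (hm n), integral_congr_ae h2,
      integral_add' (hX.integrable_indicator_state hhC (n + 1) (hm (n + 1)))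
        ((integrable_const 1).indicator hme),
      integral_indicator (hm (n + 1)), integral_indicator_const _ hme]
    simp [a]
  have ha0 : a 0 = zeroProb p M 0 := by
    have h1 : (stayEvent X M 0).indicator (fun ω => h (X 0 ω) (leftSites X 0 ω)) =ᵐ[P]
        fun _ => zeroProb p M 0 := by
      filter_upwards [hX0] with ω hω
      have hs : ω ∈ stayEvent X M 0 := fun m hm => by
        rw [Nat.le_zero.1 hm, hω]
        exact ⟨le_rfl, by exact_mod_cast hM⟩
      rw [Set.indicator_of_mem hs, hω, leftSites_zero]
      exact escapeProb_one_empty p M 0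
    simp only [a]
    rw [← integral_indicator (hm 0), integral_congr_ae h1]
    simp
  have ha : Tendsto a atTop (𝓝 0) := by
    refine squeeze_zero (fun n => integral_nonneg fun ω => (hh _ _).1) (fun n => ?_)
      (hX.tendsto_measureReal_stayEvent M)
    have := integral_mono_of_nonneg (μ := P.restrict (stayEvent X M n))
      (.of_forall fun ω => (hh (X n ω) (leftSites X n ω)).1) (integrable_const (1 : ℝ))
      (.of_forall fun ω => (hh (X n ω) (leftSites X n ω)).2)
    simpa using this
  rw [hasSum_iff_tendsto_nat_of_nonneg fun n => measureReal_nonneg]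
  simp only [hstep, Finset.sum_range_sub', ha0]
  simpa using ha.const_sub (zeroProb p M 0)

theorem IsCookieRW.measureReal_iUnion_exitEvent (hX : IsCookieRW P (fun _ => p) X)
    (hX0 : ∀ᵐ ω ∂P, X 0 ω = 1) {M : ℕ} (hM : 1 ≤ M) :
    P.real (⋃ n, exitEvent X M n) = zeroProb p M 0 := by
  have hs := hX.hasSum_measureReal_exitEvent hX0 hM
  rw [measureReal_def, measure_iUnion (pairwise_disjoint_exitEvent X M)
    (measurableSet_exitEvent hX.meas M), ENNReal.tsum_toReal_eq fun _ => measure_ne_top _ _]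
  exact hs.tsum_eq

theorem IsCookieRW.hitTime_eq_top_ae_le (hX : IsCookieRW P (fun _ => p) X)
    (hX0 : ∀ᵐ ω ∂P, X 0 ω = 1) {M : ℕ} (hM : 1 ≤ M) :
    {ω | hitTime X 0 ω = ⊤} ≤ᵐ[P] ⋃ n, exitEvent X M n := by
  have hleave : ∀ᵐ ω ∂P, ω ∉ ⋂ n, stayEvent X M n := by
    rw [← measure_eq_zero_iff_ae_notMem, ← measureReal_eq_zero_iff]
    exact le_antisymm (ge_of_tendsto' (hX.tendsto_measureReal_stayEvent M) fun n =>
      measureReal_mono (Set.iInter_subset _ n)) measureReal_nonneg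
  filter_upwards [hX.ae_step, hX0, hleave] with ω h1 h2 h3 (h4 : hitTime X 0 ω = ⊤)
  rw [hitTime_eq_top_iff] at h4
  by_contra hcon
  have hne : ∀ n, ω ∉ exitEvent X M n := fun n h => hcon (Set.mem_iUnion.2 ⟨n, h⟩)
  refine h3 (Set.mem_iInter.2 fun n => ?_)
  induction n with
  | zero =>
    intro m hm
    rw [Nat.le_zero.1 hm, h2]
    exact ⟨le_rfl, by exact_mod_cast hM⟩
  | succ n ih =>
    intro m hmn
    rcases hmn.lt_or_eq with hmn | rfl
    · exact ih m (Nat.le_of_lt_succ hmn)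
    · have hr := ih n le_rfl
      have e1 : X (n + 1) ω ≠ M + 1 := fun h => hne n ⟨ih, h⟩
      have e2 := h4 (n + 1)
      simp only [Set.mem_Icc] at hr ⊢
      rcases h1 n with h | h <;> omega

theorem IsCookieRW.tendsto_zeroProb (hX : IsCookieRW P (fun _ => p) X)
    (hX0 : ∀ᵐ ω ∂P, X 0 ω = 1) :
    Tendsto (fun M => zeroProb p M 0) atTop (𝓝 (P.real {ω | hitTime X 0 ω = ⊤})) := by
  let G : ℕ → Set Ω := fun M => {ω | ∀ k ≤ M, X k ω ≠ 0}
  have hGm : ∀ M, MeasurableSet (G M) := fun M => by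
    simp only [G, Set.ofPred_forall]
    exact .iInter fun k => .iInter fun _ => hX.meas k (measurableSet_singleton 0).compl
  have hG : Antitone G := fun _ _ h _ hω k hk => hω k (hk.trans h)
  have hGi : ⋂ M, G M = {ω | hitTime X 0 ω = ⊤} := by
    ext ω
    simp only [Set.mem_iInter, G, Set.mem_ofPred_eq, hitTime_eq_top_iff]
    exact ⟨fun h n => h n n le_rfl, fun h _ k _ => h k⟩
  have hlim := (ENNReal.tendsto_toReal (measure_ne_top P _)).comp
    (tendsto_measure_iInter_atTop (fun M => (hGm M).nullMeasurableSet) hG ⟨0, measure_ne_top P _⟩)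
  rw [hGi] at hlim
  refine tendsto_of_tendsto_of_tendsto_of_le_of_le' tendsto_const_nhds hlim ?_ ?_ <;>
    filter_upwards [eventually_ge_atTop 1] with M hM <;>
    rw [← hX.measureReal_iUnion_exitEvent hX0 hM]
  · exact ENNReal.toReal_mono (measure_ne_top _ _)
      (measure_mono_ae (hX.hitTime_eq_top_ae_le hX0 hM))
  · exact ENNReal.toReal_mono (measure_ne_top _ _)
      (measure_mono_ae (hX.iUnion_exitEvent_ae_le hX0 M))

end Walk

/-- For `p ∈ (2/3, 1)` and any invariant distribution `μ` for `qp p`,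
`P(T₀ = ∞) = μ(0) = Σ_j p^(j+1) μ(j)`. -/
theorem stmt14 (p : ℝ) (hp : p ∈ Set.Ioo (2 / 3 : ℝ) 1)
    (μ : ℕ → ℝ) (hμ : IsInvariantFor p μ)
    {Ω : Type*} [MeasurableSpace Ω] (P : Measure Ω) [IsProbabilityMeasure P]
    (X : ℕ → Ω → ℤ) (hX : IsCookieRW P (fun _ => p) X) (hX0 : ∀ᵐ ω ∂P, X 0 ω = 1) :
    (P {ω | hitTime X 0 ω = ⊤}).toReal = μ 0 ∧
    μ 0 = ∑' j : ℕ, p ^ (j + 1) * μ j := by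
  refine ⟨tendsto_nhds_unique (hX.tendsto_zeroProb hX0)
    (hμ.tendsto_zeroProb (by linarith [hp.1]) hp.2), ?_⟩
  rw [← hμ.2.2 0]
  exact tsum_congr fun j => by rw [qp_zero_right, mul_comm]
end
end

section
/- Let p ∈ (1/2, 1) and let μ be an invariant probability distribution on ℕ for the kernel q_p whose second moment is finite: Σ_{j=0}^{∞} j² μ(j) < ∞. Then (2p − 1)·Σ_{j=0}^{∞} p^{j+1} μ(j) = 2 − p + (6 − 8p)·Σ_{j=0}^{∞} j μ(j). -/
open MeasureTheory Filter

noncomputable section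

lemma hasSum_choose_add_mul_half_pow (m i : ℕ) :
    HasSum (fun n : ℕ => ((n + (m + i)).choose (m + i) : ℝ) * (1 / 2 : ℝ) ^ (m + (n + 1)))
      (2 ^ i) := by
  have h := (hasSum_choose_mul_geometric_of_norm_lt_one (m + i)
    (show ‖(1 / 2 : ℝ)‖ < 1 by norm_num)).mul_right ((1 / 2 : ℝ) ^ (m + 1))
  have e : 1 / (1 - 1 / 2 : ℝ) ^ (m + i + 1) * (1 / 2 : ℝ) ^ (m + 1) = 2 ^ i := by
    rw [show (1 - 1 / 2 : ℝ) = 1 / 2 by norm_num, show m + i + 1 = i + (m + 1) by ring, pow_add]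
    field_simp
    simp
  rw [e] at h
  refine h.congr_fun ?_
  intro n
  ring

lemma succ_mul_choose_cast (m n : ℕ) :
    ((n : ℝ) + m + 1) * ((n + m).choose m : ℝ) = (m + 1) * ((n + (m + 1)).choose (m + 1) : ℝ) := by
  have h := Nat.add_one_mul_choose_eq (n + m) m
  have h' : (((n + m + 1) * (n + m).choose m : ℕ) : ℝ)
      = (((n + m + 1).choose (m + 1) * (m + 1) : ℕ) : ℝ) := by exact_mod_cast h
  push_cast at h'
  rw [show n + (m + 1) = n + m + 1 by ring]
  linarith

lemma hasSum_choose_mul_half_pow_mul_succ (m : ℕ) :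
    HasSum (fun n : ℕ => ((m + n).choose n : ℝ) * (1 / 2 : ℝ) ^ (m + (n + 1)) * ((n : ℝ) + 1))
      (m + 2) := by
  have h := ((hasSum_choose_add_mul_half_pow m 1).mul_left ((m : ℝ) + 1)).sub
    ((hasSum_choose_add_mul_half_pow m 0).mul_left (m : ℝ))
  rw [show ((m : ℝ) + 1) * 2 ^ 1 - m * 2 ^ 0 = m + 2 by ring] at h
  refine h.congr_fun ?_
  intro n
  have h1 := succ_mul_choose_cast m n
  rw [← Nat.choose_symm_add, add_comm m n, add_zero]
  linear_combination (1 / 2 : ℝ) ^ (m + (n + 1)) * h1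

lemma hasSum_choose_mul_half_pow_mul_succ_sq (m : ℕ) :
    HasSum (fun n : ℕ => ((m + n).choose n : ℝ) * (1 / 2 : ℝ) ^ (m + (n + 1)) * ((n : ℝ) + 1) ^ 2)
      ((m : ℝ) ^ 2 + 6 * m + 6) := by
  have h := (((hasSum_choose_add_mul_half_pow m 2).mul_left (((m : ℝ) + 1) * (m + 2))).sub
    ((hasSum_choose_add_mul_half_pow m 1).mul_left ((2 * m + 1) * ((m : ℝ) + 1)))).add
    ((hasSum_choose_add_mul_half_pow m 0).mul_left ((m : ℝ) ^ 2))
  rw [show ((m : ℝ) + 1) * (m + 2) * 2 ^ 2 - (2 * m + 1) * ((m : ℝ) + 1) * 2 ^ 1 +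
    (m : ℝ) ^ 2 * 2 ^ 0 = (m : ℝ) ^ 2 + 6 * m + 6 by ring] at h
  refine h.congr_fun ?_
  intro n
  have h1 := succ_mul_choose_cast m n
  have h2 := succ_mul_choose_cast (m + 1) n
  push_cast at h2
  rw [show m + 1 + 1 = m + 2 from rfl] at h2
  rw [← Nat.choose_symm_add, add_comm m n, add_zero]
  linear_combination (1 / 2 : ℝ) ^ (m + (n + 1)) *
    ((n + m + 2 - (2 * m + 1)) * h1 + (m + 1) * h2)

lemma hasSum_qp_mul (p : ℝ) (j : ℕ) {f g : ℕ → ℝ} (hf : f 0 = 0)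
    (h : ∀ m : ℕ, HasSum
      (fun n : ℕ => ((m + n).choose n : ℝ) * (1 / 2 : ℝ) ^ (m + (n + 1)) * f (n + 1)) (g m)) :
    HasSum (fun k => qp p j k * f k)
      ((1 - p) * ∑ l ∈ Finset.range (j + 1), p ^ l * g (j - l)) := by
  rw [← hasSum_nat_add_iff' 1]
  simp only [Finset.sum_range_one, hf, mul_zero, sub_zero]
  have hs := (hasSum_sum (s := Finset.range (j + 1))
    (fun l _ => (h (j - l)).mul_left (p ^ l))).mul_left (1 - p)
  refine hs.congr_fun ?_
  intro n
  simp only [qp, Nat.add_eq_zero_iff, one_ne_zero, and_false, if_false, mul_assoc, Finset.sum_mul]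
  refine congrArg _ (Finset.sum_congr rfl fun l _ => ?_)
  rw [Nat.add_sub_cancel, ← add_assoc, Nat.add_sub_cancel]

lemma sum_pow_mul_reflect_succ (p : ℝ) (g : ℕ → ℝ) (j : ℕ) :
    ∑ l ∈ Finset.range (j + 1 + 1), p ^ l * g (j + 1 - l) =
      p * (∑ l ∈ Finset.range (j + 1), p ^ l * g (j - l)) + g (j + 1) := by
  rw [Finset.sum_range_succ', Finset.mul_sum]
  simp [pow_succ', mul_assoc]

lemma one_sub_mul_sum_pow_mul_add_two {p : ℝ} (hp : p ≠ 1) (j : ℕ) :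
    (1 - p) * ∑ l ∈ Finset.range (j + 1), p ^ l * (((j - l : ℕ) : ℝ) + 2) =
      j + 1 + (1 - 2 * p) / (1 - p) * (1 - p ^ (j + 1)) := by
  have h1 : 1 - p ≠ 0 := sub_ne_zero.2 hp.symm
  induction j with
  | zero => simp; field_simp; ring
  | succ j ih =>
    rw [sum_pow_mul_reflect_succ p (fun m => (m : ℝ) + 2), mul_add, mul_left_comm, ih]
    push_cast
    field_simp
    ring

lemma one_sub_mul_sum_pow_mul_quadratic {p : ℝ} (hp : p ≠ 1) (j : ℕ) :
    (1 - p) * ∑ l ∈ Finset.range (j + 1), p ^ l *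
        (((j - l : ℕ) : ℝ) ^ 2 + 6 * ((j - l : ℕ) : ℝ) + 6) =
      j ^ 2 + (6 - 2 * p / (1 - p)) * j + (6 - 6 * p / (1 - p) + p * (1 + p) / (1 - p) ^ 2)
        + (6 * p / (1 - p) - (1 + p) / (1 - p) ^ 2) * p ^ (j + 1) := by
  have h1 : 1 - p ≠ 0 := sub_ne_zero.2 hp.symm
  induction j with
  | zero => simp; field_simp; ring
  | succ j ih =>
    rw [sum_pow_mul_reflect_succ p (fun m => (m : ℝ) ^ 2 + 6 * m + 6), mul_add, mul_left_comm, ih]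
    push_cast
    field_simp
    ring

lemma qp_nonneg {p : ℝ} (h0 : 0 ≤ p) (h1 : p ≤ 1) (j k : ℕ) : 0 ≤ qp p j k := by
  have : 0 ≤ 1 - p := sub_nonneg.2 h1
  unfold qp
  split_ifs <;> positivity

lemma IsInvariantFor.tsum_mul_eq {p : ℝ} {μ : ℕ → ℝ} (hμ : IsInvariantFor p μ)
    (h0 : 0 ≤ p) (h1 : p ≤ 1) {f E : ℕ → ℝ} (hf : ∀ k, 0 ≤ f k)
    (hE : ∀ j, HasSum (fun k => qp p j k * f k) (E j)) (hs : Summable fun j => μ j * E j) :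
    ∑' j, μ j * E j = ∑' k, μ k * f k := by
  have hj (j : ℕ) : HasSum (fun k => μ j * (qp p j k * f k)) (μ j * E j) := (hE j).mul_left _
  have hsum : Summable (Function.uncurry fun j k => μ j * (qp p j k * f k)) := by
    refine (summable_prod_of_nonneg ?_).2 ⟨fun j => (hj j).summable, ?_⟩
    · rintro ⟨j, k⟩
      exact mul_nonneg (hμ.1 j) (mul_nonneg (qp_nonneg h0 h1 j k) (hf k))
    · refine hs.congr fun j => ?_
      exact (hj j).tsum_eq.symm
  calc ∑' j, μ j * E j = ∑' j, ∑' k, μ j * (qp p j k * f k) :=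
        tsum_congr fun j => (hj j).tsum_eq.symm
    _ = ∑' k, ∑' j, μ j * (qp p j k * f k) := hsum.tsum_comm.symm
    _ = ∑' k, μ k * f k := tsum_congr fun k => by
        simp_rw [← mul_assoc]
        rw [tsum_mul_right, hμ.2.2 k]

/-- Identity for invariant distributions of `qp p` with finite second moment. -/
theorem stmt18 (p : ℝ) (hp : p ∈ Set.Ioo (1 / 2 : ℝ) 1)
    (μ : ℕ → ℝ) (hμ : IsInvariantFor p μ)
    (h2 : Summable (fun j : ℕ => (j : ℝ) ^ 2 * μ j)) :
    (2 * p - 1) * (∑' j : ℕ, p ^ (j + 1) * μ j) =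
      2 - p + (6 - 8 * p) * (∑' j : ℕ, (j : ℝ) * μ j) := by
  obtain ⟨hp1, hp2⟩ := hp
  have hp0 : 0 ≤ p := by linarith
  have hne : 1 - p ≠ 0 := by linarith
  have s0 : Summable μ := by
    by_contra h
    have := hμ.2.1
    rw [tsum_eq_zero_of_not_summable h] at this
    exact zero_ne_one this
  have s1 : Summable fun j : ℕ => (j : ℝ) * μ j := by
    refine Summable.of_nonneg_of_le (fun j => mul_nonneg j.cast_nonneg (hμ.1 j)) (fun j => ?_) h2
    refine mul_le_mul_of_nonneg_right ?_ (hμ.1 j)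
    exact_mod_cast Nat.le_self_pow two_ne_zero j
  have sp : Summable fun j : ℕ => p ^ (j + 1) * μ j := by
    refine Summable.of_nonneg_of_le (fun j => mul_nonneg (pow_nonneg hp0 _) (hμ.1 j))
      (fun j => ?_) s0
    exact mul_le_of_le_one_left (hμ.1 j) (pow_le_one₀ hp0 hp2.le)
  have H0 : HasSum μ 1 := hμ.2.1 ▸ s0.hasSum
  have first : HasSum (fun j : ℕ => μ j * (j + 1 + (1 - 2 * p) / (1 - p) * (1 - p ^ (j + 1)))) _ :=
    ((s1.hasSum.add H0).add ((H0.sub sp.hasSum).mul_left ((1 - 2 * p) / (1 - p)))).congr_fun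
      fun j => by ring
  have second : HasSum (fun j : ℕ => μ j * (j ^ 2 + (6 - 2 * p / (1 - p)) * j
      + (6 - 6 * p / (1 - p) + p * (1 + p) / (1 - p) ^ 2)
      + (6 * p / (1 - p) - (1 + p) / (1 - p) ^ 2) * p ^ (j + 1))) _ :=
    (((h2.hasSum.add (s1.hasSum.mul_left (6 - 2 * p / (1 - p)))).add
      (H0.mul_left (6 - 6 * p / (1 - p) + p * (1 + p) / (1 - p) ^ 2))).add
      (sp.hasSum.mul_left (6 * p / (1 - p) - (1 + p) / (1 - p) ^ 2))).congr_fun fun j => by ring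
  have e1 := hμ.tsum_mul_eq hp0 hp2.le (f := fun k => (k : ℝ)) (fun k => k.cast_nonneg)
    (fun j => one_sub_mul_sum_pow_mul_add_two hp2.ne j ▸
      hasSum_qp_mul p j (g := fun m => (m : ℝ) + 2) Nat.cast_zero fun m => by
        simpa using hasSum_choose_mul_half_pow_mul_succ m) first.summable
  have e2 := hμ.tsum_mul_eq hp0 hp2.le (f := fun k => (k : ℝ) ^ 2) (fun k => by positivity)
    (fun j => one_sub_mul_sum_pow_mul_quadratic hp2.ne j ▸
      hasSum_qp_mul p j (g := fun m => (m : ℝ) ^ 2 + 6 * m + 6) (by simp) fun m => by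
        simpa using hasSum_choose_mul_half_pow_mul_succ_sq m) second.summable
  rw [first.tsum_eq] at e1
  rw [second.tsum_eq] at e2
  simp_rw [mul_comm (μ _)] at e1 e2
  generalize (∑' j : ℕ, p ^ (j + 1) * μ j) = Q at *
  generalize (∑' j : ℕ, (j : ℝ) * μ j) = M at *
  generalize (∑' j : ℕ, (j : ℝ) ^ 2 * μ j) = V at *
  have e : (2 * p - 1) * Q - (2 - p + (6 - 8 * p) * M) =
      -2 * (2 * p - 1) * (M + 1 + (1 - 2 * p) / (1 - p) * (1 - Q) - M)
      - (1 - p) * (V + (6 - 2 * p / (1 - p)) * M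
        + (6 - 6 * p / (1 - p) + p * (1 + p) / (1 - p) ^ 2)
        + (6 * p / (1 - p) - (1 + p) / (1 - p) ^ 2) * Q - V) := by
    field_simp
    ring
  linear_combination e - 2 * (2 * p - 1) * e1 - (1 - p) * e2
end
end
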